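/- Let a ∈ (-1,1), q > 0 and r > 0 be real numbers, and let (p_k) be the sequence defined by an arbitrary initial value p_1 > 0 and the Riccati iteration p_{k+1} = a²p_k − (a p_k)²/(p_k + r) + q. Then p_k converges, as k → ∞, to the unique positive solution p_∞ of the scalar discrete algebraic Riccati equation p = a²p − (ap)²/(p + r) + q. -/

import Mathlib

/-- For `a ∈ (-1,1)`, `q > 0`, `r > 0`, the Riccati iteration
`p_{k+1} = a²p_k − (a p_k)²/(p_k + r) + q`, started from any `p_1 > 0`,
converges to the unique positive solution of the scalar DARE
`p = a²p − (ap)²/(p + r) + q`. -/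
theorem riccati_iteration_tendsto_dare_solution
    (a q r : ℝ) (ha : a ∈ Set.Ioo (-1 : ℝ) 1) (hq : 0 < q) (hr : 0 < r)
    (p : ℕ → ℝ) (hp1 : 0 < p 1)
    (hrec : ∀ k ≥ 1, p (k + 1) = a ^ 2 * p k - (a * p k) ^ 2 / (p k + r) + q)
    (pinf : ℝ) (hpos : 0 < pinf)
    (hfix : pinf = a ^ 2 * pinf - (a * pinf) ^ 2 / (pinf + r) + q) :
    Filter.Tendsto p Filter.atTop (nhds pinf) := by
  have key : ∀ x : ℝ, 0 < x →
      a ^ 2 * x - (a * x) ^ 2 / (x + r) + q = a ^ 2 * (x * r / (x + r)) + q := by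
    intro x hx
    have : x + r ≠ 0 := by positivity
    field_simp
    ring
  have ha2 : a ^ 2 < 1 := by nlinarith [ha.1, ha.2]
  have hp : ∀ n : ℕ, 0 < p (n + 1) := by
    intro n
    induction n with
    | zero => simpa using hp1
    | succ n ih =>
      rw [hrec (n + 1) (by omega), key _ ih]
      positivity
  have hstep : ∀ n : ℕ, |p (n + 1 + 1) - pinf| ≤ a ^ 2 * |p (n + 1) - pinf| := by
    intro n
    have hx := hp n
    rw [key _ hpos] at hfix
    rw [hrec (n + 1) (by omega), key _ hx]
    generalize p (n + 1) = x at *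
    have h1 : a ^ 2 * (x * r / (x + r)) + q - pinf
        = a ^ 2 * (r ^ 2 / ((x + r) * (pinf + r)) * (x - pinf)) := by
      have e : a ^ 2 * (x * r / (x + r)) + q - pinf
          = a ^ 2 * (x * r / (x + r)) - a ^ 2 * (pinf * r / (pinf + r)) := by linarith
      rw [e]
      have : x + r ≠ 0 := by positivity
      have : pinf + r ≠ 0 := by positivity
      clear hfix e
      field_simp
      ring
    have h2 : r ^ 2 / ((x + r) * (pinf + r)) ≤ 1 := by
      rw [div_le_one (by positivity)]
      nlinarith [mul_pos hx hpos, mul_pos hx hr, mul_pos hpos hr]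
    have h3 : 0 ≤ r ^ 2 / ((x + r) * (pinf + r)) := by positivity
    rw [h1, abs_mul, abs_mul, abs_of_nonneg (sq_nonneg a), abs_of_nonneg h3]
    exact mul_le_mul_of_nonneg_left (mul_le_of_le_one_left (abs_nonneg _) h2) (sq_nonneg a)
  have hb : ∀ n : ℕ, |p (n + 1) - pinf| ≤ (a ^ 2) ^ n * |p 1 - pinf| := by
    intro n
    induction n with
    | zero => simp
    | succ n ih =>
      refine (hstep n).trans ?_
      rw [pow_succ' (a ^ 2) n, mul_assoc]
      exact mul_le_mul_of_nonneg_left ih (sq_nonneg a)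
  rw [← Filter.tendsto_add_atTop_iff_nat 1, tendsto_iff_norm_sub_tendsto_zero]
  refine squeeze_zero (fun _ => norm_nonneg _) hb ?_
  simpa using (tendsto_pow_atTop_nhds_zero_of_lt_one (sq_nonneg a) ha2).mul_const |p 1 - pinf|
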